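/- For any real k > -1, the k-th area moment of a random triangle in the unit square equals (24/(2^k (1+k)(2+k)^2(3+k)^2)) · ∫₀¹ (1 - x^{k+2})/(1 - x) dx. -/

import Mathlib

open MeasureTheory

/-- The uniform distribution on `[0,1]`. -/
noncomputable abbrev unitUniform : Measure ℝ := volume.restrict (Set.Icc (0:ℝ) 1)

theorem lintegral_uIcc_eq (a b : ℝ) (f : ℝ → ENNReal) :
    ∫⁻ x in Set.uIcc a b, f x
      = ENNReal.ofReal |b - a| * ∫⁻ t, f (a + t * (b - a)) ∂unitUniform := by
  rcases eq_or_ne a b with rfl | hab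
  · simp
  have himg : (fun t : ℝ => a + t * (b - a)) '' Set.Icc 0 1 = Set.uIcc a b := by
    rw [← segment_eq_uIcc, segment_eq_image']
    rfl
  rw [← himg, lintegral_image_eq_lintegral_abs_deriv_mul (f' := fun _ => b - a) measurableSet_Icc]
  · rw [lintegral_const_mul' _ _ ENNReal.ofReal_ne_top]
  · intro x _
    simpa using (((hasDerivAt_id x).mul_const (b - a)).const_add a).hasDerivWithinAt
  · intro x _ y _ hxy
    simpa [sub_ne_zero.2 hab.symm] using hxy

theorem lintegral_unit_split {w : ℝ} (hw : w ∈ Set.Icc (0:ℝ) 1) (f : ℝ → ENNReal) :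
    ∫⁻ y, f y ∂unitUniform = (∫⁻ y in Set.uIcc w 0, f y) + ∫⁻ y in Set.uIcc w 1, f y := by
  rw [Set.uIcc_of_ge hw.1, Set.uIcc_of_le hw.2, ← restrict_Ioc_eq_restrict_Icc (a := w),
    ← lintegral_union measurableSet_Ioc, Set.Icc_union_Ioc_eq_Icc hw.1 hw.2]
  exact Set.disjoint_left.2 fun x hx hx' => absurd hx'.1 (not_lt.2 hx.2)

theorem ae_unitUniform_mem : ∀ᵐ x ∂unitUniform, x ∈ Set.Icc (0:ℝ) 1 :=
  ae_restrict_mem measurableSet_Icc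

theorem ae_unitUniform_ne (c : ℝ) : ∀ᵐ x ∂unitUniform, x ≠ c := by
  refine ae_restrict_of_ae ?_
  simp [ae_iff]

theorem lintegral_unit_rpow {r : ℝ} (hr : -1 < r) :
    ∫⁻ t, ENNReal.ofReal (t ^ r) ∂unitUniform = ENNReal.ofReal (1 / (r + 1)) := by
  rw [← ofReal_integral_eq_lintegral_ofReal]
  · rw [integral_Icc_eq_integral_Ioc, ← intervalIntegral.integral_of_le zero_le_one,
      integral_rpow (Or.inl hr), Real.one_rpow, Real.zero_rpow (by linarith), sub_zero]
  · change IntegrableOn _ _ _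
    rw [integrableOn_Icc_iff_integrableOn_Ioc,
      ← intervalIntegrable_iff_integrableOn_Ioc_of_le zero_le_one]
    exact intervalIntegral.intervalIntegrable_rpow' hr
  · filter_upwards [ae_unitUniform_mem] with t ht
    exact Real.rpow_nonneg ht.1 r

theorem mul_rpow_abs {r : ℝ} (hr : -1 < r) (x : ℝ) : |x| * |x| ^ r = |x| ^ (r + 1) := by
  rw [Real.rpow_add_one' (abs_nonneg x) (by linarith), mul_comm]

theorem lintegral_uIcc_abs_sub_rpow {r : ℝ} (hr : -1 < r) (w b : ℝ) :
    ∫⁻ y in Set.uIcc w b, ENNReal.ofReal (|y - w| ^ r)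
      = ENNReal.ofReal (|b - w| ^ (r + 1) / (r + 1)) := by
  have h : ∀ᵐ t ∂unitUniform, ENNReal.ofReal (|w + t * (b - w) - w| ^ r)
      = ENNReal.ofReal (|b - w| ^ r) * ENNReal.ofReal (t ^ r) := by
    filter_upwards [ae_unitUniform_mem] with t ht
    rw [← ENNReal.ofReal_mul (by positivity), add_sub_cancel_left, abs_mul, abs_of_nonneg ht.1,
      Real.mul_rpow ht.1 (abs_nonneg _), mul_comm]
  rw [lintegral_uIcc_eq, lintegral_congr_ae h, lintegral_const_mul' _ _ ENNReal.ofReal_ne_top,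
    lintegral_unit_rpow hr, ← ENNReal.ofReal_mul (by positivity),
    ← ENNReal.ofReal_mul (by positivity), ← mul_assoc, mul_rpow_abs hr, mul_one_div]

theorem lintegral_unit_abs_sub_rpow {r : ℝ} (hr : -1 < r) {w : ℝ} (hw : w ∈ Set.Icc (0:ℝ) 1) :
    ∫⁻ y, ENNReal.ofReal (|y - w| ^ r) ∂unitUniform
      = ENNReal.ofReal (1 / (r + 1)) *
        (ENNReal.ofReal (w ^ (r + 1)) + ENNReal.ofReal ((1 - w) ^ (r + 1))) := by
  have hr' : 0 < r + 1 := by linarith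
  have hw' := sub_nonneg.2 hw.2
  have hw0 := hw.1
  rw [lintegral_unit_split hw, lintegral_uIcc_abs_sub_rpow hr, lintegral_uIcc_abs_sub_rpow hr,
    zero_sub, abs_neg, abs_of_nonneg hw0, abs_of_nonneg hw',
    ← ENNReal.ofReal_add (by positivity) (by positivity),
    ← ENNReal.ofReal_add (by positivity) (by positivity), ← ENNReal.ofReal_mul (by positivity)]
  congr 1
  ring

theorem lintegral_unit_comp_one_sub (f : ℝ → ENNReal) :
    ∫⁻ u, f (1 - u) ∂unitUniform = ∫⁻ u, f u ∂unitUniform := by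
  have h := lintegral_uIcc_eq 1 0 f
  rw [Set.uIcc_of_ge zero_le_one] at h
  rw [h]
  simp [sub_eq_add_neg]

theorem lintegral_unit_unit_abs_sub_rpow {r : ℝ} (hr : -1 < r) :
    ∫⁻ x, ∫⁻ z, ENNReal.ofReal (|z - x| ^ r) ∂unitUniform ∂unitUniform
      = ENNReal.ofReal (2 / ((r + 1) * (r + 2))) := by
  have hr' : 0 < r + 1 := by linarith
  have hr2 : 0 < r + 2 := by linarith
  rw [lintegral_congr_ae (ae_unitUniform_mem.mono fun x hx => lintegral_unit_abs_sub_rpow hr hx),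
    lintegral_const_mul' _ _ ENNReal.ofReal_ne_top, lintegral_add_left (by fun_prop),
    lintegral_unit_comp_one_sub (fun u => ENNReal.ofReal (u ^ (r + 1))),
    lintegral_unit_rpow (by linarith), ← ENNReal.ofReal_add (by positivity) (by positivity),
    ← ENNReal.ofReal_mul (by positivity)]
  congr 1
  field_simp
  ring

theorem lintegral_segment_rpow {r : ℝ} (hr : -1 < r) {x : ℝ} (hx : x ∈ Set.Ico (0:ℝ) 1) :
    ∫⁻ t, ENNReal.ofReal ((x + t * (1 - x)) ^ r) ∂unitUniform
      = ENNReal.ofReal (1 / (r + 1) * ((1 - x ^ (r + 1)) / (1 - x))) := by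
  have hr' : 0 < r + 1 := by linarith
  have hx1 : 0 < 1 - x := sub_pos.2 hx.2
  have hx0 := hx.1
  have h0 : ∫⁻ y in Set.uIcc x 0, ENNReal.ofReal (y ^ r) = ENNReal.ofReal (x ^ (r + 1) / (r + 1)) := by
    have := lintegral_uIcc_abs_sub_rpow hr 0 x
    simp only [sub_zero, abs_of_nonneg hx0] at this
    rw [Set.uIcc_comm, ← this, Set.uIcc_of_le hx0]
    refine setLIntegral_congr_fun measurableSet_Icc fun y hy => ?_
    simp only [abs_of_nonneg hy.1]
  have h := lintegral_unit_split ⟨hx0, hx.2.le⟩ (fun y => ENNReal.ofReal (y ^ r))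
  rw [h0, lintegral_unit_rpow hr, lintegral_uIcc_eq, abs_of_pos hx1] at h
  have h1 : ENNReal.ofReal (1 - x) * ∫⁻ t, ENNReal.ofReal ((x + t * (1 - x)) ^ r) ∂unitUniform
      = ENNReal.ofReal (1 / (r + 1) - x ^ (r + 1) / (r + 1)) := by
    rw [ENNReal.ofReal_sub (1 / (r + 1)) (by positivity), h, ENNReal.add_sub_cancel_left ENNReal.ofReal_ne_top]
  have h2 : ENNReal.ofReal (1 - x) ≠ 0 := by simpa using hx.2
  rw [← ENNReal.mul_right_inj h2 ENNReal.ofReal_ne_top, h1, ← ENNReal.ofReal_mul hx1.le]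
  congr 1
  field_simp

theorem lintegral_unit_ite {s : Set ℝ} (hs : MeasurableSet s) {p : ℝ → Prop} [DecidablePred p]
    (hp : ∀ x, x ∈ s ↔ p x ∧ x ∈ Set.Icc (0:ℝ) 1) (f : ℝ → ENNReal) :
    ∫⁻ x, (if p x then f x else 0) ∂unitUniform = ∫⁻ x in s, f x := by
  rw [← Set.inter_eq_left.2 (fun x hx => ((hp x).1 hx).2 : s ⊆ Set.Icc (0:ℝ) 1),
    ← Measure.restrict_restrict hs, ← lintegral_indicator hs]
  refine setLIntegral_congr_fun measurableSet_Icc fun x hx => ?_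
  have hx' : x ∈ s ↔ p x := by simp [hp x, hx.1, hx.2]
  by_cases h : p x
  · simp [h, hx'.2 h]
  · simp [h, mt hx'.1 h]

theorem lintegral_unit_unit_of_symm {f : ℝ → ℝ → ENNReal} (hf : Measurable (Function.uncurry f))
    (hsymm : ∀ u v, f u v = f v u) :
    ∫⁻ u, ∫⁻ v, f u v ∂unitUniform ∂unitUniform
      = 2 * ∫⁻ v, ENNReal.ofReal v * ∫⁻ x, f v (x * v) ∂unitUniform ∂unitUniform := by
  have hm : Measurable (Function.uncurry fun u v => if u ≤ v then f u v else 0) :=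
    Measurable.ite (measurableSet_le measurable_fst measurable_snd) hf measurable_const
  have hlow : ∀ v ∈ Set.Icc (0:ℝ) 1, ∫⁻ u in Set.uIcc v 0, f v u
      = ENNReal.ofReal v * ∫⁻ x, f v (x * v) ∂unitUniform := by
    intro v hv
    rw [Set.uIcc_comm, lintegral_uIcc_eq]
    simp [abs_of_nonneg hv.1]
  have hupper : ∫⁻ u, (∫⁻ v in Set.uIcc u 1, f u v) ∂unitUniform
      = ∫⁻ v, (∫⁻ u in Set.uIcc v 0, f v u) ∂unitUniform := by
    calc ∫⁻ u, (∫⁻ v in Set.uIcc u 1, f u v) ∂unitUniform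
        = ∫⁻ u, ∫⁻ v, (if u ≤ v then f u v else 0) ∂unitUniform ∂unitUniform := by
          refine lintegral_congr_ae ?_
          filter_upwards [ae_unitUniform_mem] with u hu
          refine (lintegral_unit_ite measurableSet_uIcc (fun v => ?_) _).symm
          rw [Set.uIcc_of_le hu.2]
          exact ⟨fun h => ⟨h.1, hu.1.trans h.1, h.2⟩, fun h => ⟨h.1, h.2.2⟩⟩
      _ = ∫⁻ v, ∫⁻ u, (if u ≤ v then f u v else 0) ∂unitUniform ∂unitUniform :=
          lintegral_lintegral_swap hm.aemeasurable
      _ = _ := by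
          refine lintegral_congr_ae ?_
          filter_upwards [ae_unitUniform_mem] with v hv
          simp only [hsymm _ v]
          refine lintegral_unit_ite measurableSet_uIcc (fun u => ?_) _
          rw [Set.uIcc_of_ge hv.1]
          exact ⟨fun h => ⟨h.2, h.1, h.2.trans hv.2⟩, fun h => ⟨h.2.1, h.1⟩⟩
  have hlow' := lintegral_congr_ae (ae_unitUniform_mem.mono hlow)
  have hmeas : Measurable fun v => ENNReal.ofReal v * ∫⁻ x, f v (x * v) ∂unitUniform := by
    have : Measurable (Function.uncurry fun v x : ℝ => f v (x * v)) :=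
      hf.comp (measurable_fst.prodMk (measurable_snd.mul measurable_fst))
    exact (by fun_prop : Measurable ENNReal.ofReal).mul this.lintegral_prod_right
  rw [lintegral_congr_ae (ae_unitUniform_mem.mono fun u hu => lintegral_unit_split hu (f u)),
    lintegral_add_left', hupper, hlow', two_mul]
  exact hmeas.aemeasurable.congr (Filter.EventuallyEq.symm (ae_unitUniform_mem.mono hlow))

theorem integrable_one_sub_rpow_div {r : ℝ} (hr : 0 < r) :
    Integrable (fun x : ℝ => (1 - x ^ (r + 1)) / (1 - x)) unitUniform := by
  refine Integrable.of_bound (Measurable.aestronglyMeasurable (by fun_prop)) (r + 1) ?_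
  filter_upwards [ae_unitUniform_mem] with x hx
  rcases hx.2.eq_or_lt with rfl | hx1
  · simp; linarith
  have h1 : 0 < 1 - x := sub_pos.2 hx1
  have h2 : x ^ (r + 1) ≤ 1 := Real.rpow_le_one hx.1 hx.2 (by linarith)
  rw [Real.norm_of_nonneg (div_nonneg (sub_nonneg.2 h2) h1.le), div_le_iff₀ h1]
  have := one_add_mul_self_le_rpow_one_add (s := x - 1) (p := r + 1) (by linarith [hx.1]) (by linarith)
  rw [add_sub_cancel] at this
  linarith

theorem lintegral_convexComb_rpow {r : ℝ} (hr : 0 < r) :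
    ∫⁻ u, ∫⁻ v, ∫⁻ t, ENNReal.ofReal ((u + t * (v - u)) ^ r)
        ∂unitUniform ∂unitUniform ∂unitUniform
      = ENNReal.ofReal (2 / ((r + 1) * (r + 2)) *
          ∫ x in Set.Icc (0:ℝ) 1, (1 - x ^ (r + 1)) / (1 - x)) := by
  have hsymm : ∀ u v : ℝ, ∫⁻ t, ENNReal.ofReal ((u + t * (v - u)) ^ r) ∂unitUniform
      = ∫⁻ t, ENNReal.ofReal ((v + t * (u - v)) ^ r) ∂unitUniform := by
    intro u v
    rw [← lintegral_unit_comp_one_sub]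
    congr! 4
    ring
  have hpos : 0 ≤ᵐ[unitUniform] fun x : ℝ => (1 - x ^ (r + 1)) / (1 - x) := by
    filter_upwards [ae_unitUniform_mem] with x hx
    exact div_nonneg (sub_nonneg.2 (Real.rpow_le_one hx.1 hx.2 (by linarith))) (sub_nonneg.2 hx.2)
  have hinner : ∀ v ∈ Set.Icc (0:ℝ) 1,
      ∫⁻ x, ∫⁻ t, ENNReal.ofReal ((v + t * (x * v - v)) ^ r) ∂unitUniform ∂unitUniform
        = ENNReal.ofReal (v ^ r) * ENNReal.ofReal (1 / (r + 1) *
          ∫ x in Set.Icc (0:ℝ) 1, (1 - x ^ (r + 1)) / (1 - x)) := by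
    intro v hv
    rw [ENNReal.ofReal_mul (by positivity),
      ofReal_integral_eq_lintegral_ofReal (integrable_one_sub_rpow_div hr) hpos,
      ← lintegral_const_mul' _ _ ENNReal.ofReal_ne_top,
      ← lintegral_const_mul' _ _ ENNReal.ofReal_ne_top]
    refine lintegral_congr_ae ?_
    filter_upwards [ae_unitUniform_mem, ae_unitUniform_ne 1] with x hx hx1
    rw [← ENNReal.ofReal_mul (by positivity),
      ← lintegral_segment_rpow (by linarith) ⟨hx.1, lt_of_le_of_ne hx.2 hx1⟩, hsymm,
      ← lintegral_const_mul' _ _ ENNReal.ofReal_ne_top]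
    refine lintegral_congr_ae ?_
    filter_upwards [ae_unitUniform_mem] with t ht
    have : 0 ≤ x + t * (1 - x) := add_nonneg hx.1 (mul_nonneg ht.1 (sub_nonneg.2 hx.2))
    rw [← ENNReal.ofReal_mul (Real.rpow_nonneg hv.1 r), ← Real.mul_rpow hv.1 this]
    congr 2
    ring
  have houter : ∀ v ∈ Set.Icc (0:ℝ) 1, ENNReal.ofReal v * ENNReal.ofReal (v ^ r)
      = ENNReal.ofReal (v ^ (r + 1)) := by
    intro v hv
    rw [← ENNReal.ofReal_mul hv.1, Real.rpow_add_one' hv.1 (by linarith), mul_comm]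
  rw [lintegral_unit_unit_of_symm ?_ hsymm]
  · rw [lintegral_congr_ae (ae_unitUniform_mem.mono fun v hv => by
      rw [hinner v hv, ← mul_assoc, houter v hv]), lintegral_mul_const' _ _ ENNReal.ofReal_ne_top,
      lintegral_unit_rpow (by linarith), ← ENNReal.ofReal_mul (by positivity),
      ← ENNReal.ofReal_ofNat 2, ← ENNReal.ofReal_mul (by positivity)]
    congr 1
    field_simp
    ring
  · have : Measurable (Function.uncurry fun (z : ℝ × ℝ) (t : ℝ) =>
        ENNReal.ofReal ((z.1 + t * (z.2 - z.1)) ^ r)) := by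
      unfold Function.uncurry
      fun_prop
    exact this.lintegral_prod_right

theorem lintegral_rotate {α : Type*} [MeasurableSpace α] {ν : Measure α} [SFinite ν]
    {G : α → α → α → ENNReal} (hG : Measurable fun z : α × α × α => G z.1 z.2.1 z.2.2) :
    ∫⁻ p, ∫⁻ q, ∫⁻ r, G q r p ∂ν ∂ν ∂ν = ∫⁻ p, ∫⁻ q, ∫⁻ r, G p q r ∂ν ∂ν ∂ν := by
  rw [lintegral_lintegral_swap]
  · refine lintegral_congr fun q => lintegral_lintegral_swap (Measurable.aemeasurable ?_)
    exact hG.comp (measurable_const.prodMk (measurable_snd.prodMk measurable_fst))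
  · refine Measurable.aemeasurable (Measurable.lintegral_prod_right
      (f := fun (z : α × α) (r : α) => G z.2 r z.1) ?_)
    exact hG.comp (measurable_fst.snd.prodMk (measurable_snd.prodMk measurable_fst.fst))

theorem lintegral_add_add {α : Type*} [MeasurableSpace α] {ν : Measure α} {f g : α → ENNReal}
    (hf : Measurable f) (hg : Measurable g) (h : α → ENNReal) :
    ∫⁻ x, (f x + g x + h x) ∂ν = (∫⁻ x, f x ∂ν) + (∫⁻ x, g x ∂ν) + ∫⁻ x, h x ∂ν := by
  rw [lintegral_add_left (f := fun x => f x + g x) (hf.add hg), lintegral_add_left hf]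

theorem lintegral_eq_three_mul {α : Type*} [MeasurableSpace α] {ν : Measure α} [SFinite ν]
    {F b : α → α → α → ENNReal} (hF : Measurable fun z : α × α × α => F z.1 z.2.1 z.2.2)
    (hb : Measurable fun z : α × α × α => b z.1 z.2.1 z.2.2)
    (hrot : ∀ p q r, F q r p = F p q r)
    (hsum : ∀ᵐ p ∂ν, ∀ᵐ q ∂ν, ∀ᵐ r ∂ν, b p q r + b q r p + b r p q = 1) :
    ∫⁻ p, ∫⁻ q, ∫⁻ r, F p q r ∂ν ∂ν ∂ν
      = 3 * ∫⁻ p, ∫⁻ q, ∫⁻ r, F p q r * b p q r ∂ν ∂ν ∂ν := by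
  have hG : Measurable fun z : α × α × α => F z.1 z.2.1 z.2.2 * b z.1 z.2.1 z.2.2 := hF.mul hb
  have hG1 : Measurable fun z : α × α × α => F z.2.1 z.2.2 z.1 * b z.2.1 z.2.2 z.1 :=
    hG.comp (measurable_snd.fst.prodMk (measurable_snd.snd.prodMk measurable_fst))
  have h1 := lintegral_rotate (ν := ν) (G := fun p q r => F p q r * b p q r) hG
  have h2 := lintegral_rotate (ν := ν) (G := fun p q r => F q r p * b q r p) hG1
  have hA : Measurable fun z : (α × α) × α => F z.1.1 z.1.2 z.2 * b z.1.1 z.1.2 z.2 :=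
    hG.comp (measurable_fst.fst.prodMk (measurable_fst.snd.prodMk measurable_snd))
  have hB : Measurable fun z : (α × α) × α => F z.1.2 z.2 z.1.1 * b z.1.2 z.2 z.1.1 :=
    hG1.comp (measurable_fst.fst.prodMk (measurable_fst.snd.prodMk measurable_snd))
  have hA2 : Measurable fun z : α × α => ∫⁻ r, F z.1 z.2 r * b z.1 z.2 r ∂ν :=
    hA.lintegral_prod_right'
  have hB2 : Measurable fun z : α × α => ∫⁻ r, F z.2 r z.1 * b z.2 r z.1 ∂ν :=
    hB.lintegral_prod_right'
  calc ∫⁻ p, ∫⁻ q, ∫⁻ r, F p q r ∂ν ∂ν ∂ν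
      = ∫⁻ p, ∫⁻ q, ∫⁻ r, (F p q r * b p q r + F q r p * b q r p + F r p q * b r p q)
          ∂ν ∂ν ∂ν := by
        refine lintegral_congr_ae (hsum.mono fun p hp => lintegral_congr_ae (hp.mono fun q hq =>
          lintegral_congr_ae (hq.mono fun r hr => ?_)))
        simp only
        rw [hrot p q r, ← hrot r p q, ← mul_add, ← mul_add, hr, mul_one]
    _ = ∫⁻ p, ∫⁻ q, ((∫⁻ r, F p q r * b p q r ∂ν) + (∫⁻ r, F q r p * b q r p ∂ν)
          + ∫⁻ r, F r p q * b r p q ∂ν) ∂ν ∂ν := by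
        refine lintegral_congr fun p => lintegral_congr fun q => ?_
        have m1 : Measurable fun r => F p q r * b p q r := hA.comp (measurable_prodMk_left (x := (p, q)))
        have m2 : Measurable fun r => F q r p * b q r p :=
          hB.comp (measurable_prodMk_left (x := (p, q)))
        exact lintegral_add_add m1 m2 _
    _ = ∫⁻ p, ((∫⁻ q, ∫⁻ r, F p q r * b p q r ∂ν ∂ν) + (∫⁻ q, ∫⁻ r, F q r p * b q r p ∂ν ∂ν)
          + ∫⁻ q, ∫⁻ r, F r p q * b r p q ∂ν ∂ν) ∂ν := by
        refine lintegral_congr fun p => ?_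
        have m1 : Measurable fun q => ∫⁻ r, F p q r * b p q r ∂ν := hA2.comp measurable_prodMk_left
        have m2 : Measurable fun q => ∫⁻ r, F q r p * b q r p ∂ν := hB2.comp measurable_prodMk_left
        exact lintegral_add_add m1 m2 _
    _ = _ := by
        have m1 := hA2.lintegral_prod_right' (ν := ν)
        have m2 := hB2.lintegral_prod_right' (ν := ν)
        rw [lintegral_add_add m1 m2, h2, h1]
        ring

/-- The uniform distribution on the unit square. -/
noncomputable abbrev squareUniform : Measure (ℝ × ℝ) := unitUniform.prod unitUniform

/-- Twice the area of the triangle with vertices `p`, `q`, `r`. -/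
noncomputable def doubleArea (p q r : ℝ × ℝ) : ℝ :=
  |(q.1 - p.1) * (r.2 - p.2) - (r.1 - p.1) * (q.2 - p.2)|

theorem doubleArea_rotate (p q r : ℝ × ℝ) : doubleArea q r p = doubleArea p q r := by
  unfold doubleArea
  congr 1
  ring

theorem measurable_doubleArea :
    Measurable fun z : (ℝ × ℝ) × (ℝ × ℝ) × (ℝ × ℝ) => doubleArea z.1 z.2.1 z.2.2 := by
  unfold doubleArea
  exact Measurable.abs (by fun_prop)

/-- The indicator of `q` lying horizontally between `p` and `r`. -/
noncomputable def between (p q r : ℝ × ℝ) : ENNReal :=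
  (Set.uIcc p.1 r.1).indicator 1 q.1

theorem measurable_between :
    Measurable fun z : (ℝ × ℝ) × (ℝ × ℝ) × (ℝ × ℝ) => between z.1 z.2.1 z.2.2 := by
  have hs : MeasurableSet {z : (ℝ × ℝ) × (ℝ × ℝ) × (ℝ × ℝ) |
      z.1.1 ⊓ z.2.2.1 ≤ z.2.1.1 ∧ z.2.1.1 ≤ z.1.1 ⊔ z.2.2.1} :=
    (measurableSet_le (measurable_fst.fst.inf measurable_snd.snd.fst) measurable_snd.fst.fst).inter
      (measurableSet_le measurable_snd.fst.fst (measurable_fst.fst.sup measurable_snd.snd.fst))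
  exact (measurable_const (a := (1 : ENNReal))).indicator hs

theorem between_add_between_add_between {p q r : ℝ × ℝ} (hpq : q.1 ≠ p.1) (hrp : r.1 ≠ p.1)
    (hrq : r.1 ≠ q.1) : between p q r + between q r p + between r p q = 1 := by
  simp only [between]
  rcases hpq.lt_or_gt with h1 | h1 <;> rcases hrp.lt_or_gt with h2 | h2 <;>
    rcases hrq.lt_or_gt with h3 | h3 <;>
    first
    | exfalso; linarith
    | simp [h1.le, h2.le, h3.le, h1.not_ge, h2.not_ge, h3.not_ge]

theorem ae_squareUniform_fst_ne (c : ℝ) : ∀ᵐ p ∂squareUniform, p.1 ≠ c :=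
  Measure.quasiMeasurePreserving_fst.ae (ae_unitUniform_ne c)

theorem ae_squareUniform_mem :
    ∀ᵐ p ∂squareUniform, p.1 ∈ Set.Icc (0:ℝ) 1 ∧ p.2 ∈ Set.Icc (0:ℝ) 1 :=
  (Measure.quasiMeasurePreserving_fst.ae ae_unitUniform_mem).and
    (Measure.quasiMeasurePreserving_snd.ae ae_unitUniform_mem)

theorem lintegral_doubleArea_between {k : ℝ} (hk : -1 < k) {p r : ℝ × ℝ}
    (hp : p.1 ∈ Set.Icc (0:ℝ) 1 ∧ p.2 ∈ Set.Icc (0:ℝ) 1)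
    (hr : r.1 ∈ Set.Icc (0:ℝ) 1 ∧ r.2 ∈ Set.Icc (0:ℝ) 1) :
    ∫⁻ q, ENNReal.ofReal (doubleArea p q r ^ k) * between p q r ∂squareUniform
      = ENNReal.ofReal (|r.1 - p.1| ^ (k + 1)) *
        (ENNReal.ofReal (1 / (k + 1)) * ∫⁻ t,
          (ENNReal.ofReal ((p.2 + t * (r.2 - p.2)) ^ (k + 1)) +
            ENNReal.ofReal ((1 - (p.2 + t * (r.2 - p.2))) ^ (k + 1))) ∂unitUniform) := by
  have hq : Measurable fun q : ℝ × ℝ => (p, q, r) := by fun_prop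
  have hm : Measurable fun q => ENNReal.ofReal (doubleArea p q r ^ k) * between p q r :=
    ((measurable_doubleArea.comp hq).pow_const k).ennreal_ofReal.mul (measurable_between.comp hq)
  have hsub : Set.uIcc p.1 r.1 ⊆ Set.Icc 0 1 := Set.uIcc_subset_Icc hp.1 hr.1
  rw [lintegral_prod _ hm.aemeasurable]
  calc _ = ∫⁻ x, (Set.uIcc p.1 r.1).indicator
          (fun x => ∫⁻ y, ENNReal.ofReal (doubleArea p (x, y) r ^ k) ∂unitUniform) x
            ∂unitUniform := by
        refine lintegral_congr fun x => ?_
        by_cases hx : x ∈ Set.uIcc p.1 r.1 <;> simp [between, hx]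
    _ = ∫⁻ x in Set.uIcc p.1 r.1, ∫⁻ y, ENNReal.ofReal (doubleArea p (x, y) r ^ k)
          ∂unitUniform := by
        rw [lintegral_indicator measurableSet_uIcc, Measure.restrict_restrict measurableSet_uIcc,
          Set.inter_eq_left.2 hsub]
    _ = _ := by
        rw [lintegral_uIcc_eq, ← mul_rpow_abs hk, ENNReal.ofReal_mul (abs_nonneg _), mul_assoc]
        congr 1
        rw [← lintegral_const_mul' _ _ ENNReal.ofReal_ne_top,
          ← lintegral_const_mul' _ _ ENNReal.ofReal_ne_top]
        refine lintegral_congr_ae ?_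
        filter_upwards [ae_unitUniform_mem] with t ht
        have hw : p.2 + t * (r.2 - p.2) ∈ Set.Icc (0:ℝ) 1 := by
          have := convex_Icc (0:ℝ) 1 hp.2 hr.2 (sub_nonneg.2 ht.2) ht.1 (by ring)
          convert this using 1
          simp only [smul_eq_mul]
          ring
        rw [← lintegral_unit_abs_sub_rpow hk hw, ← lintegral_const_mul' _ _ ENNReal.ofReal_ne_top]
        refine lintegral_congr fun y => ?_
        rw [← ENNReal.ofReal_mul (by positivity), ← Real.mul_rpow (abs_nonneg _) (abs_nonneg _),
          ← abs_mul, doubleArea, ← abs_neg]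
        congr 3
        ring

theorem lintegral_convexComb_add {r : ℝ} (hr : 0 < r) :
    ∫⁻ u, ∫⁻ v, ∫⁻ t, (ENNReal.ofReal ((u + t * (v - u)) ^ r) +
          ENNReal.ofReal ((1 - (u + t * (v - u))) ^ r)) ∂unitUniform ∂unitUniform ∂unitUniform
      = 2 * ENNReal.ofReal (2 / ((r + 1) * (r + 2)) *
          ∫ x in Set.Icc (0:ℝ) 1, (1 - x ^ (r + 1)) / (1 - x)) := by
  have hm : Measurable (fun z : ℝ × ℝ =>
      ∫⁻ t, ENNReal.ofReal ((z.1 + t * (z.2 - z.1)) ^ r) ∂unitUniform) := by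
    fun_prop
  have hreflect : ∫⁻ u, ∫⁻ v, ∫⁻ t, ENNReal.ofReal ((1 - (u + t * (v - u))) ^ r)
        ∂unitUniform ∂unitUniform ∂unitUniform
      = ∫⁻ u, ∫⁻ v, ∫⁻ t, ENNReal.ofReal ((u + t * (v - u)) ^ r)
        ∂unitUniform ∂unitUniform ∂unitUniform := by
    rw [← lintegral_unit_comp_one_sub]
    refine lintegral_congr fun u => ?_
    rw [← lintegral_unit_comp_one_sub]
    refine lintegral_congr fun v => lintegral_congr fun t => ?_
    congr 2
    ring
  rw [← lintegral_convexComb_rpow hr, two_mul]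
  nth_rw 2 [← hreflect]
  rw [← lintegral_add_left hm.lintegral_prod_right']
  refine lintegral_congr fun u => ?_
  rw [← lintegral_add_left (f := fun v => ∫⁻ t, ENNReal.ofReal ((u + t * (v - u)) ^ r) ∂unitUniform)
    (hm.comp measurable_prodMk_left)]
  refine lintegral_congr fun v => ?_
  rw [← lintegral_add_left (by fun_prop)]

theorem lintegral_doubleArea_rpow {k : ℝ} (hk : -1 < k) :
    ∫⁻ p, ∫⁻ q, ∫⁻ r, ENNReal.ofReal (doubleArea p q r ^ k)
        ∂squareUniform ∂squareUniform ∂squareUniform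
      = ENNReal.ofReal (24 / ((1 + k) * (2 + k) ^ 2 * (3 + k) ^ 2) *
          ∫ x in Set.Icc (0:ℝ) 1, (1 - x ^ (k + 2)) / (1 - x)) := by
  have h1 : 0 < k + 1 := by linarith
  have hF : Measurable fun z : (ℝ × ℝ) × (ℝ × ℝ) × (ℝ × ℝ) =>
      ENNReal.ofReal (doubleArea z.1 z.2.1 z.2.2 ^ k) :=
    (measurable_doubleArea.pow_const k).ennreal_ofReal
  rw [lintegral_eq_three_mul (F := fun p q r => ENNReal.ofReal (doubleArea p q r ^ k))
    hF measurable_between (fun p q r => by rw [doubleArea_rotate])]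
  swap
  · refine Filter.Eventually.of_forall fun p => ?_
    filter_upwards [ae_squareUniform_fst_ne p.1] with q hq
    filter_upwards [ae_squareUniform_fst_ne p.1, ae_squareUniform_fst_ne q.1] with r hrp hrq
    exact between_add_between_add_between hq hrp hrq
  have hswap : ∀ p, ∫⁻ q, ∫⁻ r, ENNReal.ofReal (doubleArea p q r ^ k) * between p q r
        ∂squareUniform ∂squareUniform
      = ∫⁻ r, ∫⁻ q, ENNReal.ofReal (doubleArea p q r ^ k) * between p q r
        ∂squareUniform ∂squareUniform := fun p =>
    lintegral_lintegral_swap ((hF.mul measurable_between).comp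
      (measurable_prodMk_left (x := p))).aemeasurable
  set a : ℝ → ℝ → ENNReal := fun x z => ENNReal.ofReal (|z - x| ^ (k + 1)) with ha
  set c : ℝ → ℝ → ENNReal := fun u v => ∫⁻ t, (ENNReal.ofReal ((u + t * (v - u)) ^ (k + 1)) +
    ENNReal.ofReal ((1 - (u + t * (v - u))) ^ (k + 1))) ∂unitUniform with hc
  have ham : Measurable (Function.uncurry a) := by
    simp only [ha, Function.uncurry_def]
    exact ((Measurable.abs (by fun_prop)).pow_const _).ennreal_ofReal
  have hcm : Measurable (Function.uncurry c) := by
    simp only [hc, Function.uncurry_def]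
    fun_prop
  calc _ = 3 * ∫⁻ p, ENNReal.ofReal (1 / (k + 1)) *
          ((∫⁻ z, a p.1 z ∂unitUniform) * ∫⁻ v, c p.2 v ∂unitUniform) ∂squareUniform := by
        congr 1
        refine lintegral_congr_ae ?_
        filter_upwards [ae_squareUniform_mem] with p hp
        rw [hswap, ← lintegral_prod_mul (f := a p.1) (g := c p.2)
          (ham.comp measurable_prodMk_left).aemeasurable
          (hcm.comp measurable_prodMk_left).aemeasurable,
          ← lintegral_const_mul' _ _ ENNReal.ofReal_ne_top]
        refine lintegral_congr_ae ?_
        filter_upwards [ae_squareUniform_mem] with r hr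
        rw [lintegral_doubleArea_between hk hp hr, mul_left_comm]
    _ = 3 * (ENNReal.ofReal (1 / (k + 1)) * ((∫⁻ x, ∫⁻ z, a x z ∂unitUniform ∂unitUniform) *
          ∫⁻ u, ∫⁻ v, c u v ∂unitUniform ∂unitUniform)) := by
        rw [lintegral_const_mul' _ _ ENNReal.ofReal_ne_top,
          lintegral_prod_mul ham.lintegral_prod_right.aemeasurable
            hcm.lintegral_prod_right.aemeasurable]
    _ = _ := by
        rw [lintegral_unit_unit_abs_sub_rpow (by linarith), lintegral_convexComb_add h1,
          show k + 1 + 1 = k + 2 by ring, show k + 1 + 2 = k + 3 by ring,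
          ← ENNReal.ofReal_ofNat 2, ← ENNReal.ofReal_ofNat 3]
        have h2 : 0 < k + 2 := by linarith
        have h3 : 0 < k + 3 := by linarith
        rw [← ENNReal.ofReal_mul (by positivity), ← ENNReal.ofReal_mul (by positivity),
          ← ENNReal.ofReal_mul (by positivity), ← ENNReal.ofReal_mul (by positivity)]
        congr 1
        rw [add_comm 1 k, add_comm 2 k, add_comm 3 k]
        field_simp
        ring

/-- The measurable identification of the Euclidean plane with `ℝ × ℝ`. -/
noncomputable def euclideanPlaneEquivProd : EuclideanSpace ℝ (Fin 2) ≃ᵐ ℝ × ℝ :=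
  (MeasurableEquiv.toLp 2 (Fin 2 → ℝ)).symm.trans MeasurableEquiv.finTwoArrow

theorem euclideanPlaneEquivProd_apply (x : EuclideanSpace ℝ (Fin 2)) :
    euclideanPlaneEquivProd x = (x 0, x 1) := rfl

theorem measurePreserving_euclideanPlaneEquivProd :
    MeasurePreserving euclideanPlaneEquivProd volume volume :=
  (volume_preserving_finTwoArrow ℝ).comp (EuclideanSpace.volume_preserving_symm_measurableEquiv_toLp _)

theorem volume_standardTriangle :
    volume {x : EuclideanSpace ℝ (Fin 2) | 0 ≤ x 0 ∧ 0 ≤ x 1 ∧ x 0 + x 1 ≤ 1}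
      = ENNReal.ofReal (1 / 2) := by
  have hpre : {x : EuclideanSpace ℝ (Fin 2) | 0 ≤ x 0 ∧ 0 ≤ x 1 ∧ x 0 + x 1 ≤ 1}
      = euclideanPlaneEquivProd ⁻¹' {z : ℝ × ℝ | 0 ≤ z.1 ∧ 0 ≤ z.2 ∧ z.1 + z.2 ≤ 1} := rfl
  have hmeas : MeasurableSet {z : ℝ × ℝ | 0 ≤ z.1 ∧ 0 ≤ z.2 ∧ z.1 + z.2 ≤ 1} :=
    (measurableSet_le measurable_const measurable_fst).inter
      ((measurableSet_le measurable_const measurable_snd).inter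
        (measurableSet_le (measurable_fst.add measurable_snd) measurable_const))
  have hsec : ∀ x : ℝ, volume (Prod.mk x ⁻¹' {z : ℝ × ℝ | 0 ≤ z.1 ∧ 0 ≤ z.2 ∧ z.1 + z.2 ≤ 1})
      = Set.indicator (Set.Icc 0 1) (fun x => ENNReal.ofReal (1 - x)) x := by
    intro x
    by_cases hx : x ∈ Set.Icc (0:ℝ) 1
    · rw [Set.indicator_of_mem hx]
      have : Prod.mk x ⁻¹' {z : ℝ × ℝ | 0 ≤ z.1 ∧ 0 ≤ z.2 ∧ z.1 + z.2 ≤ 1}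
          = Set.Icc 0 (1 - x) := by
        ext y
        simp [hx.1, le_sub_iff_add_le']
      rw [this, Real.volume_Icc, sub_zero]
    · rw [Set.indicator_of_notMem hx]
      convert measure_empty (μ := (volume : Measure ℝ))
      ext y
      simp only [Set.mem_preimage, Set.mem_ofPred_eq, Set.mem_empty_iff_false, iff_false]
      exact fun h => hx ⟨h.1, by linarith⟩
  rw [hpre, measurePreserving_euclideanPlaneEquivProd.measure_preimage_equiv, Measure.volume_eq_prod,
    Measure.prod_apply hmeas, lintegral_congr hsec, lintegral_indicator measurableSet_Icc,
    ← ofReal_integral_eq_lintegral_ofReal]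
  · rw [integral_Icc_eq_integral_Ioc, ← intervalIntegral.integral_of_le zero_le_one,
      intervalIntegral.integral_comp_sub_left (fun x : ℝ => x), integral_id]
    norm_num
  · exact (by fun_prop : Continuous fun x : ℝ => 1 - x).integrableOn_Icc
  · filter_upwards [ae_restrict_mem measurableSet_Icc] with x hx
    exact sub_nonneg.2 hx.2

theorem volume_convexHull_triple (x₀ x₁ x₂ : EuclideanSpace ℝ (Fin 2)) :
    (volume (convexHull ℝ {x₀, x₁, x₂})).toReal
      = |(x₁ 0 - x₀ 0) * (x₂ 1 - x₀ 1) - (x₂ 0 - x₀ 0) * (x₁ 1 - x₀ 1)| / 2 := by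
  set B := (EuclideanSpace.basisFun (Fin 2) ℝ).toBasis with hB
  set M : Matrix (Fin 2) (Fin 2) ℝ := !![x₁ 0 - x₀ 0, x₂ 0 - x₀ 0; x₁ 1 - x₀ 1, x₂ 1 - x₀ 1] with hM
  set f := Matrix.toLin B B M with hf
  have hfx : ∀ x, f x = x 0 • (x₁ - x₀) + x 1 • (x₂ - x₀) := by
    intro x
    ext i
    fin_cases i <;> simp [hf, hB, hM, Matrix.toLin_apply, Matrix.mulVec, dotProduct, Fin.sum_univ_two] <;> ring
  have hhull : convexHull ℝ {x₀, x₁, x₂}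
      = (x₀ + ·) '' (f '' {x : EuclideanSpace ℝ (Fin 2) | 0 ≤ x 0 ∧ 0 ≤ x 1 ∧ x 0 + x 1 ≤ 1}) := by
    ext z
    rw [convexHull_insert (by simp), convexHull_pair, mem_convexJoin]
    simp only [Set.mem_singleton_iff, exists_eq_left, Set.image_image, Set.mem_image,
      Set.mem_ofPred_eq, hfx]
    constructor
    · rintro ⟨y, ⟨a, b, ha, hb, hab, rfl⟩, c, d, hc, hd, hcd, rfl⟩
      refine ⟨!₂[d * a, d * b], ⟨?_, ?_, ?_⟩, ?_⟩
      · simpa using mul_nonneg hd ha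
      · simpa using mul_nonneg hd hb
      · simp only [Matrix.cons_val_zero, Matrix.cons_val_one]
        rw [← mul_add, hab]; linarith
      · obtain rfl : c = 1 - d := by linarith
        obtain rfl : a = 1 - b := by linarith
        simp only [Matrix.cons_val_zero, Matrix.cons_val_one]
        module
    · rintro ⟨x, ⟨h0, h1, h2⟩, rfl⟩
      rcases (add_nonneg h0 h1).eq_or_lt with hs | hs
      · have e0 : x 0 = 0 := by linarith
        have e1 : x 1 = 0 := by linarith
        refine ⟨x₁, left_mem_segment _ _ _, ?_⟩
        simpa [e0, e1] using left_mem_segment ℝ x₀ x₁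
      · refine ⟨(x 0 / (x 0 + x 1)) • x₁ + (x 1 / (x 0 + x 1)) • x₂,
          ⟨_, _, by positivity, by positivity, by field_simp, rfl⟩,
          1 - (x 0 + x 1), x 0 + x 1, by linarith, hs.le, by ring, ?_⟩
        rw [smul_add, smul_smul, smul_smul, mul_div_cancel₀ _ hs.ne', mul_div_cancel₀ _ hs.ne']
        module
  rw [hhull, Set.image_add_left, measure_preimage_add, Measure.addHaar_image_linearMap,
    volume_standardTriangle, hf, LinearMap.det_toLin, hM, Matrix.det_fin_two_of,
    ENNReal.toReal_mul, ENNReal.toReal_ofReal (abs_nonneg _), ENNReal.toReal_ofReal (by norm_num)]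
  ring_nf

theorem setIntegral_unitSquare {F : EuclideanSpace ℝ (Fin 2) → ℝ} {G : ℝ × ℝ → ℝ}
    (h : ∀ x, F x = G (x 0, x 1)) :
    ∫ x in {x : EuclideanSpace ℝ (Fin 2) | ∀ i, x i ∈ Set.Icc (0:ℝ) 1}, F x
      = ∫ p, G p ∂squareUniform := by
  have hpre : {x : EuclideanSpace ℝ (Fin 2) | ∀ i, x i ∈ Set.Icc (0:ℝ) 1}
      = euclideanPlaneEquivProd ⁻¹' (Set.Icc (0:ℝ) 1 ×ˢ Set.Icc (0:ℝ) 1) := by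
    ext x
    simp only [Set.mem_ofPred_eq, Fin.forall_fin_two, Set.mem_preimage,
      euclideanPlaneEquivProd_apply, Set.mem_prod]
  rw [hpre, squareUniform, unitUniform, Measure.prod_restrict, ← Measure.volume_eq_prod,
    ← measurePreserving_euclideanPlaneEquivProd.setIntegral_preimage_emb
      euclideanPlaneEquivProd.measurableEmbedding]
  simp only [h, euclideanPlaneEquivProd_apply]

theorem integral_doubleArea_rpow {k : ℝ} (hk : -1 < k) :
    ∫ p, ∫ q, ∫ r, (doubleArea p q r / 2) ^ k ∂squareUniform ∂squareUniform ∂squareUniform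
      = 24 / ((2:ℝ) ^ k * (1 + k) * (2 + k) ^ 2 * (3 + k) ^ 2) *
          ∫ x in Set.Icc (0:ℝ) 1, (1 - x ^ (k + 2)) / (1 - x) := by
  have hnn : ∀ p q r, 0 ≤ doubleArea p q r := fun p q r => abs_nonneg _
  have hI : 0 ≤ ∫ x in Set.Icc (0:ℝ) 1, (1 - x ^ (k + 2)) / (1 - x) := by
    refine setIntegral_nonneg measurableSet_Icc fun x hx => ?_
    exact div_nonneg (sub_nonneg.2 (Real.rpow_le_one hx.1 hx.2 (by linarith))) (sub_nonneg.2 hx.2)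
  have hm : Measurable fun z : (ℝ × ℝ) × (ℝ × ℝ) × (ℝ × ℝ) => doubleArea z.1 z.2.1 z.2.2 ^ k :=
    measurable_doubleArea.pow_const k
  have hpos : ∀ z : (ℝ × ℝ) × (ℝ × ℝ) × (ℝ × ℝ), 0 ≤ doubleArea z.1 z.2.1 z.2.2 ^ k :=
    fun z => Real.rpow_nonneg (hnn _ _ _) k
  have hlint : ∫⁻ z, ENNReal.ofReal (doubleArea z.1 z.2.1 z.2.2 ^ k)
      ∂(squareUniform.prod (squareUniform.prod squareUniform))
      = ENNReal.ofReal (24 / ((1 + k) * (2 + k) ^ 2 * (3 + k) ^ 2) *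
          ∫ x in Set.Icc (0:ℝ) 1, (1 - x ^ (k + 2)) / (1 - x)) := by
    rw [lintegral_prod _ hm.ennreal_ofReal.aemeasurable, ← lintegral_doubleArea_rpow hk]
    refine lintegral_congr fun p => lintegral_prod _ ?_
    exact (hm.ennreal_ofReal.comp (measurable_prodMk_left (x := p))).aemeasurable
  have hint : Integrable (fun z : (ℝ × ℝ) × (ℝ × ℝ) × (ℝ × ℝ) => doubleArea z.1 z.2.1 z.2.2 ^ k)
      (squareUniform.prod (squareUniform.prod squareUniform)) := by
    refine ⟨hm.aestronglyMeasurable, ?_⟩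
    rw [hasFiniteIntegral_iff_ofReal (Filter.Eventually.of_forall hpos), hlint]
    exact ENNReal.ofReal_lt_top
  have hprod : ∫ p, ∫ q, ∫ r, doubleArea p q r ^ k ∂squareUniform ∂squareUniform ∂squareUniform
      = 24 / ((1 + k) * (2 + k) ^ 2 * (3 + k) ^ 2) *
          ∫ x in Set.Icc (0:ℝ) 1, (1 - x ^ (k + 2)) / (1 - x) := by
    have h1 : 0 < 1 + k := by linarith
    calc _ = ∫ z, doubleArea z.1 z.2.1 z.2.2 ^ k
          ∂(squareUniform.prod (squareUniform.prod squareUniform)) := by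
          rw [integral_prod _ hint]
          refine integral_congr_ae ?_
          filter_upwards [hint.prod_right_ae] with p hp
          exact (integral_prod _ hp).symm
      _ = _ := by
          rw [integral_eq_lintegral_of_nonneg_ae (Filter.Eventually.of_forall hpos)
            hm.aestronglyMeasurable, hlint, ENNReal.toReal_ofReal (by positivity)]
  have hdiv : ∀ p q r, (doubleArea p q r / 2) ^ k = doubleArea p q r ^ k / 2 ^ k :=
    fun p q r => Real.div_rpow (hnn p q r) zero_le_two k
  simp only [hdiv, integral_div, hprod]
  rw [div_mul_eq_mul_div, div_mul_eq_mul_div, div_div]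
  congr 1
  ring

/-- For any real `k > -1`, the k-th area moment of a random triangle in the unit square
equals `(24/(2^k (1+k)(2+k)²(3+k)²)) · ∫₀¹ (1 - x^{k+2})/(1 - x) dx`. -/
theorem stmt_4 (k : ℝ) (hk : -1 < k) :
    (∫ x₀ in {x : EuclideanSpace ℝ (Fin 2) | ∀ i, x i ∈ Set.Icc (0:ℝ) 1},
        ∫ x₁ in {x : EuclideanSpace ℝ (Fin 2) | ∀ i, x i ∈ Set.Icc (0:ℝ) 1},
          ∫ x₂ in {x : EuclideanSpace ℝ (Fin 2) | ∀ i, x i ∈ Set.Icc (0:ℝ) 1},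
            (volume (convexHull ℝ {x₀, x₁, x₂})).toReal ^ k)
      = 24 / ((2:ℝ) ^ k * (1 + k) * (2 + k) ^ 2 * (3 + k) ^ 2) *
          ∫ x in Set.Icc (0:ℝ) 1, (1 - x ^ (k + 2)) / (1 - x) := by
  rw [← integral_doubleArea_rpow hk]
  refine setIntegral_unitSquare fun x₀ => setIntegral_unitSquare fun x₁ =>
    setIntegral_unitSquare fun x₂ => ?_
  rw [volume_convexHull_triple]
  rfl
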